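/- Let A and B be n×n Hermitian matrices over ℂ. Then ∑_{j=1}^n λ_j↓(A) λ_j↑(B) ≤ tr(AB), where λ↓(M) (resp. λ↑(M)) denotes the list of eigenvalues of M, counted with multiplicity, arranged in nonincreasing (resp. nondecreasing) order. -/

import Mathlib

/-- Averaging the rearrangement inequality over a doubly stochastic matrix. -/
theorem Antivary.sum_mul_le_sum_sum_of_mem_doublyStochastic {ι : Type*} [Fintype ι]
    [DecidableEq ι] {f g : ι → ℝ} (hfg : Antivary f g) {M : Matrix ι ι ℝ}
    (hM : M ∈ doublyStochastic ℝ ι) :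
    ∑ i, f i * g i ≤ ∑ i, ∑ j, M i j * (f i * g j) := by
  obtain ⟨w, hw, hw1, rfl⟩ := exists_eq_sum_perm_of_mem_doublyStochastic hM
  calc ∑ i, f i * g i = ∑ p : Equiv.Perm ι, w p * ∑ i, f i * g i := by
        rw [← Finset.sum_mul, hw1, one_mul]
    _ ≤ ∑ p : Equiv.Perm ι, w p * ∑ i, f i * g (p i) :=
        Finset.sum_le_sum fun p _ =>
          mul_le_mul_of_nonneg_left hfg.sum_mul_le_sum_mul_comp_perm (hw p)
    _ = ∑ p : Equiv.Perm ι, ∑ i, ∑ j, w p * p.permMatrix ℝ i j * (f i * g j) := by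
        simp [Finset.mul_sum, Equiv.Perm.permMatrix, PEquiv.toMatrix_apply]
    _ = _ := by
        rw [Finset.sum_comm]
        refine Finset.sum_congr rfl fun i _ => ?_
        rw [Finset.sum_comm]
        simp [Matrix.sum_apply, Finset.sum_mul]

/-- The squared moduli of the entries of a unitary matrix form a doubly stochastic matrix. -/
theorem Matrix.normSq_mem_doublyStochastic_of_mem_unitaryGroup {ι : Type*} [Fintype ι]
    [DecidableEq ι] {W : Matrix ι ι ℂ} (hW : W ∈ Matrix.unitaryGroup ι ℂ) :
    W.map Complex.normSq ∈ doublyStochastic ℝ ι := by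
  refine mem_doublyStochastic_iff_sum.2 ⟨fun i j => Complex.normSq_nonneg _, fun i => ?_,
    fun j => ?_⟩
  · have h := congrFun (congrFun (Matrix.mem_unitaryGroup_iff.1 hW) i) i
    simp only [Matrix.mul_apply, Matrix.star_apply, Matrix.one_apply_eq, RCLike.star_def,
      Complex.mul_conj] at h
    exact_mod_cast h
  · have h := congrFun (congrFun (Matrix.mem_unitaryGroup_iff'.1 hW) j) j
    simp only [Matrix.mul_apply, Matrix.star_apply, Matrix.one_apply_eq, RCLike.star_def,
      ← Complex.normSq_eq_conj_mul_self] at h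
    exact_mod_cast h

/-- The trace of a product of Hermitian matrices in terms of their eigenvalues and the
transition matrix between their eigenbases. -/
theorem Matrix.IsHermitian.trace_mul_eq_sum {ι : Type*} [Fintype ι] [DecidableEq ι]
    {A B : Matrix ι ι ℂ} (hA : A.IsHermitian) (hB : B.IsHermitian) :
    (A * B).trace = ((∑ i, ∑ j, Complex.normSq
      ((star hA.eigenvectorUnitary * hB.eigenvectorUnitary : Matrix.unitaryGroup ι ℂ).1 i j) *
        (hA.eigenvalues i * hB.eigenvalues j) : ℝ) : ℂ) := by
  set W : Matrix ι ι ℂ :=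
    (star hA.eigenvectorUnitary * hB.eigenvectorUnitary : Matrix.unitaryGroup ι ℂ).1 with hW
  have hAB : (A * B).trace = (Matrix.diagonal (RCLike.ofReal ∘ hA.eigenvalues) *
      (W * Matrix.diagonal (RCLike.ofReal ∘ hB.eigenvalues) * star W)).trace := by
    conv_lhs => rw [hA.spectral_theorem, hB.spectral_theorem, Unitary.conjStarAlgAut_apply,
      Unitary.conjStarAlgAut_apply, Matrix.mul_assoc, Matrix.mul_assoc, Matrix.trace_mul_comm]
    simp [hW, Matrix.mul_assoc]
  rw [hAB]
  simp only [Matrix.trace, Matrix.diag_apply, Matrix.diagonal_mul, Matrix.mul_apply (M := W * _),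
    Matrix.mul_diagonal, Matrix.star_apply, Function.comp_apply, Finset.mul_sum]
  push_cast
  refine Finset.sum_congr rfl fun i _ => Finset.sum_congr rfl fun j _ => ?_
  rw [← Complex.mul_conj]
  simp only [RCLike.star_def, Complex.coe_algebraMap]
  ring



/-- Let `A` and `B` be `n × n` Hermitian matrices over `ℂ`.  If
`σ` and `τ` are permutations of the indices arranging the eigenvalues of `A`
(counted with multiplicity) into nonincreasing order `λ↓(A)` and the eigenvalues
of `B` into nondecreasing order `λ↑(B)` respectively, then
`∑_j λ_j↓(A) * λ_j↑(B) ≤ tr (A * B)` (the trace being real). -/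
theorem eigenvalue_desc_asc_inner_le_trace_mul {n : ℕ}
    (A B : Matrix (Fin n) (Fin n) ℂ)
    (hA : A.IsHermitian) (hB : B.IsHermitian)
    (σ τ : Equiv.Perm (Fin n))
    (hσ : Antitone (hA.eigenvalues ∘ σ))
    (hτ : Monotone (hB.eigenvalues ∘ τ)) :
    ∑ j : Fin n, hA.eigenvalues (σ j) * hB.eigenvalues (τ j)
      ≤ ((A * B).trace).re := by
  have hanti : Antivary (hA.eigenvalues ∘ σ) (hB.eigenvalues ∘ τ) := hσ.antivary hτ
  set W : Matrix.unitaryGroup (Fin n) ℂ := star hA.eigenvectorUnitary * hB.eigenvectorUnitary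
  have hM : (W.1.map Complex.normSq).submatrix σ τ ∈ doublyStochastic ℝ (Fin n) := by
    obtain ⟨h0, hr, hc⟩ := mem_doublyStochastic_iff_sum.1
      (Matrix.normSq_mem_doublyStochastic_of_mem_unitaryGroup W.2)
    exact mem_doublyStochastic_iff_sum.2 ⟨fun i j => h0 _ _,
      fun i => (Equiv.sum_comp τ _).trans (hr (σ i)),
      fun j => (Equiv.sum_comp σ fun i => W.1.map Complex.normSq i (τ j)).trans (hc (τ j))⟩
  refine (hanti.sum_mul_le_sum_sum_of_mem_doublyStochastic hM).trans_eq ?_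
  rw [hA.trace_mul_eq_sum hB, Complex.ofReal_re, ← Equiv.sum_comp σ fun i => ∑ j,
    Complex.normSq (W.1 i j) * (hA.eigenvalues i * hB.eigenvalues j)]
  exact Finset.sum_congr rfl fun i _ => Equiv.sum_comp τ fun j =>
    Complex.normSq (W.1 (σ i) j) * (hA.eigenvalues (σ i) * hB.eigenvalues j)
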